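/- Let ξ be an injective primitive substitution of constant length q on a finite alphabet A with |A| > 1, such that for some α ∈ A the word ξ(α) begins with α, and let (X_ξ, μ^ξ, T) be the associated uniquely ergodic substitutional dynamical system. Then the Koopman operator f ↦ f∘T on L²(X_ξ, μ^ξ) has purely point spectrum (i.e., admits an orthonormal basis of eigenfunctions) if and only if c(ξ) = h(ξ), where h(ξ) is the height and c(ξ) the column number of ξ. -/

import Mathlib

open MeasureTheory Filter Set
open scoped ENNReal

/-- A semimetric on a set: symmetric, nonnegative, vanishing on the diagonal,
satisfying the triangle inequality. -/
structure IsSemimetric {Y : Type*} (ρ : Y → Y → ℝ) : Prop where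
  refl : ∀ x, ρ x x = 0
  symm : ∀ x y, ρ x y = ρ y x
  nonneg : ∀ x y, 0 ≤ ρ x y
  triangle : ∀ x y z, ρ x z ≤ ρ x y + ρ y z

/-- `ρ` is separable on the set `s`: some countable subset of `s` is `ρ`-dense in `s`. -/
def SeparableWRT {Y : Type*} (ρ : Y → Y → ℝ) (s : Set Y) : Prop :=
  ∃ D : Set Y, D.Countable ∧ D ⊆ s ∧ ∀ x ∈ s, ∀ ε : ℝ, 0 < ε → ∃ y ∈ D, ρ x y < ε

variable {X : Type*} [MeasurableSpace X]

/-- A semimetric is admissible if it is separable on a measurable subset of full measure. -/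
def IsAdmissible (μ : Measure X) (ρ : X → X → ℝ) : Prop :=
  ∃ s : Set X, MeasurableSet s ∧ μ sᶜ = 0 ∧ SeparableWRT ρ s

/-- There is a partition `X₀, X₁, …, X_k` of `X` into measurable pieces with `μ X₀ < ε`
and the `ρ`-diameter of `X_j` (1 ≤ j ≤ k) less than `ε`. -/
def IsEntropyPartition (μ : Measure X) (ρ : X → X → ℝ) (ε : ℝ) (k : ℕ) : Prop :=
  ∃ P : Fin (k + 1) → Set X,
    (∀ j, MeasurableSet (P j)) ∧
    Pairwise (fun i j => Disjoint (P i) (P j)) ∧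
    (⋃ j, P j) = Set.univ ∧
    μ (P 0) < ENNReal.ofReal ε ∧
    ∀ j, j ≠ 0 → ∀ x ∈ P j, ∀ y ∈ P j, ρ x y < ε

open scoped Classical in
/-- The Kolmogorov ε-entropy `ℍ_ε(X, μ, ρ)` of a semimetric triple: `log₂ k` for the least
`k` admitting an entropy partition, and `∞` if there is none. -/
noncomputable def epsEntropy (μ : Measure X) (ρ : X → X → ℝ) (ε : ℝ) : ℝ≥0∞ :=
  if h : ∃ k, IsEntropyPartition μ ρ ε k
  then ENNReal.ofReal (Real.logb 2 (Nat.find h))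
  else ⊤

/-- The average `T^n_av ρ = (1/n) ∑_{k=0}^{n-1} T^k ρ`, where `T^k ρ (x, y) = ρ (T^k x, T^k y)`
(one-sided version, for a not necessarily invertible transformation `T`). -/
noncomputable def avgSemimetricM (T : X → X) (ρ : X → X → ℝ) (n : ℕ) : X → X → ℝ :=
  fun x y => (∑ k ∈ Finset.range n, ρ (T^[k] x) (T^[k] y)) / n

/-- `h` is a scaling sequence for the semimetric `ρ` w.r.t. the transformation `T`:
`h` is positive, for every `ε > 0` the sequence `ℍ_ε(X, μ, T^n_av ρ)/h_n` has finite limsup,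
and for all sufficiently small `ε > 0` it has positive liminf. Sequences are indexed by
`n = 1, 2, …`. -/
def IsScalingSeqM (μ : Measure X) (T : X → X) (ρ : X → X → ℝ) (h : ℕ → ℝ) : Prop :=
  (∀ n, 1 ≤ n → 0 < h n) ∧
  (∀ ε : ℝ, 0 < ε →
    Filter.limsup (fun n : ℕ =>
      epsEntropy μ (avgSemimetricM T ρ n) ε / ENNReal.ofReal (h n)) Filter.atTop < ⊤) ∧
  (∃ ε₀ : ℝ, 0 < ε₀ ∧ ∀ ε : ℝ, 0 < ε → ε < ε₀ →
    0 < Filter.liminf (fun n : ℕ =>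
      epsEntropy μ (avgSemimetricM T ρ n) ε / ENNReal.ofReal (h n)) Filter.atTop)

/-- `ρ` is generating for `(X, μ, T)`: the shifts `T^k ρ` separate points of a subset of full
measure (one-sided version). -/
def IsGeneratingM (μ : Measure X) (T : X → X) (ρ : X → X → ℝ) : Prop :=
  ∃ s : Set X, MeasurableSet s ∧ μ sᶜ = 0 ∧
    ∀ x ∈ s, ∀ y ∈ s, x ≠ y → ∃ k : ℕ, 0 < ρ (T^[k] x) (T^[k] y)

/-- `h` is a scaling entropy sequence of the system `(X, μ, T)`: it is a scaling sequence for
some summable admissible measurable generating semimetric. -/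
def IsScalingEntropySeqM (μ : Measure X) (T : X → X) (h : ℕ → ℝ) : Prop :=
  ∃ ρ : X → X → ℝ, IsSemimetric ρ ∧
    Measurable (fun p : X × X => ρ p.1 p.2) ∧
    MeasureTheory.Integrable (fun p : X × X => ρ p.1 p.2) (μ.prod μ) ∧
    IsAdmissible μ ρ ∧ IsGeneratingM μ T ρ ∧ IsScalingSeqM μ T ρ h

/-- The Koopman operator `f ↦ f ∘ T` on `L²(X, μ)` has purely point spectrum: `L²(X, μ)`
possesses an orthonormal (Hilbert) basis consisting of eigenfunctions of `f ↦ f ∘ T`. -/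
def HasPurePointSpectrum (μ : Measure X) (T : X → X) : Prop :=
  ∃ (ι : Type) (b : HilbertBasis ι ℂ (MeasureTheory.Lp ℂ 2 μ)),
    ∀ i : ι, ∃ c : ℂ, (fun x => (b i : MeasureTheory.Lp ℂ 2 μ) (T x))
      =ᵐ[μ] fun x => c * (b i : MeasureTheory.Lp ℂ 2 μ) x

/-- The action of a substitution `ξ` of constant length `q` on one-sided infinite words:
the `j`-th letter of `ξ(u)` is the `(j % q)`-th letter of `ξ` applied to the `(j / q)`-th
letter of `u`. -/
def substApply {A : Type*} {q : ℕ} (hq : 0 < q) (ξ : A → Fin q → A) (u : ℕ → A) : ℕ → A :=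
  fun j => ξ (u (j / q)) ⟨j % q, Nat.mod_lt j hq⟩

/-- A substitution of constant length `q` is primitive if for some `n ≥ 1` the word `ξⁿ(a)`
contains every letter of the alphabet, for every letter `a`.  Here `ξⁿ(a)` is read off as the
first `qⁿ` letters of the `n`-th iterate of `ξ` on any word starting with `a`. -/
def IsPrimitiveSubst {A : Type*} {q : ℕ} (hq : 0 < q) (ξ : A → Fin q → A) : Prop :=
  ∃ n : ℕ, 0 < n ∧ ∀ a b : A, ∃ k : ℕ, k < q ^ n ∧ (substApply hq ξ)^[n] (fun _ => a) k = b

/-- The height `h(ξ)` of a constant length `q` substitution with fixed point `u`: the greatest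
`k` relatively prime to `q` such that `u_n = u_0` implies `k ∣ n`. -/
noncomputable def substHeight {A : Type*} {q : ℕ} (hq : 0 < q) (ξ : A → Fin q → A)
    (u : ℕ → A) : ℕ :=
  sSup {k : ℕ | Nat.Coprime k q ∧ ∀ n : ℕ, u n = u 0 → k ∣ n}

/-- The column number `c(ξ)`: the minimum over `n ≥ 1` and `0 ≤ k < qⁿ` of the number of
distinct letters `ξⁿ(a)_k`, `a ∈ A`. -/
noncomputable def substColumnNumber {A : Type*} [Fintype A] [DecidableEq A] {q : ℕ}
    (hq : 0 < q) (ξ : A → Fin q → A) : ℕ :=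
  sInf {m : ℕ | ∃ n : ℕ, 0 < n ∧ ∃ k : ℕ, k < q ^ n ∧
    m = (Finset.univ.image fun a : A => (substApply hq ξ)^[n] (fun _ => a) k).card}

/-- The left shift on one-sided infinite words. -/
def shiftMap (A : Type*) : (ℕ → A) → (ℕ → A) := fun x n => x (n + 1)

/-- The orbit closure `X_ξ` of the fixed point `u` under the left shift, in the product
topology. -/
def substOrbitClosure (A : Type*) [TopologicalSpace A] (u : ℕ → A) : Set (ℕ → A) :=
  closure {x : ℕ → A | ∃ n : ℕ, x = (shiftMap A)^[n] u}

/-- The column maps. -/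
def colMap {A : Type*} {q : ℕ} (hq : 0 < q) (ξ : A → Fin q → A) (n k : ℕ) (a : A) : A :=
  (substApply hq ξ)^[n] (fun _ => a) k

theorem iter_block {A : Type*} {q : ℕ} (hq : 0 < q) (ξ : A → Fin q → A) (n : ℕ) (v : ℕ → A) :
    ∀ i j : ℕ, j < q ^ n → (substApply hq ξ)^[n] v (i * q ^ n + j) = colMap hq ξ n j (v i) := by
  induction n with
  | zero =>
    intro i j hj
    have : j = 0 := by simpa using hj
    subst this
    simp [colMap]
  | succ n ih =>
    intro i j hj
    have h1 : (i * q ^ (n + 1) + j) / q = i * q ^ n + j / q := by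
      rw [pow_succ, ← mul_assoc, mul_comm _ q, Nat.mul_add_div hq]
    have h2 : (i * q ^ (n + 1) + j) % q = j % q := by
      rw [pow_succ, ← mul_assoc, mul_comm _ q, Nat.mul_add_mod]
    have h3 : j / q < q ^ n := by
      rw [Nat.div_lt_iff_lt_mul hq]; rwa [pow_succ] at hj
    unfold colMap
    rw [Function.iterate_succ_apply', Function.iterate_succ_apply']
    simp only [substApply, h1, h2]
    rw [ih i _ h3, colMap]

theorem colMap_add {A : Type*} {q : ℕ} (hq : 0 < q) (ξ : A → Fin q → A) (n m i j : ℕ) (a : A)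
    (hj : j < q ^ n) :
    colMap hq ξ (n + m) (i * q ^ n + j) a = colMap hq ξ n j (colMap hq ξ m i a) := by
  conv_lhs => unfold colMap
  rw [Function.iterate_add_apply, iter_block hq ξ n _ i j hj]
  rfl

theorem fix_block {A : Type*} {q : ℕ} (hq : 0 < q) (ξ : A → Fin q → A) (u : ℕ → A)
    (hufix : substApply hq ξ u = u) (n i j : ℕ) (hj : j < q ^ n) :
    u (i * q ^ n + j) = colMap hq ξ n j (u i) := by
  rw [← iter_block hq ξ n u i j hj, Function.iterate_fixed hufix]

theorem two_le_q {A : Type*} [Fintype A] (hcard : 1 < Fintype.card A) {q : ℕ} (hq : 0 < q)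
    (ξ : A → Fin q → A) (hprim : IsPrimitiveSubst hq ξ) : 2 ≤ q := by
  by_contra hlt
  have hq1 : q = 1 := by omega
  subst hq1
  obtain ⟨a, b, hab⟩ := Fintype.one_lt_card_iff.1 hcard
  obtain ⟨n, _, h⟩ := hprim
  obtain ⟨k, hk, h1⟩ := h a a
  obtain ⟨k', hk', h2⟩ := h a b
  have e1 : k = 0 := by simpa using hk
  have e2 : k' = 0 := by simpa using hk'
  subst e1; subst e2
  exact hab (h1.symm.trans h2)

/-- Uniform recurrence of two-point patterns. -/
theorem syndetic {A : Type*} {q : ℕ} (hq : 0 < q) (h2 : 2 ≤ q)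
    (ξ : A → Fin q → A) (hprim : IsPrimitiveSubst hq ξ) (u : ℕ → A)
    (hufix : substApply hq ξ u = u) (i0 m : ℕ) :
    ∃ K : ℕ, ∀ s : ℕ, ∃ t, s ≤ t ∧ t < s + K ∧ u t = u i0 ∧ u (t + m) = u (i0 + m) := by
  obtain ⟨n0, _, hp⟩ := hprim
  set n := i0 + m with hn
  have hlt : i0 + m < q ^ n := Nat.lt_pow_self (by omega)
  refine ⟨(2 * q ^ n0 + 2) * q ^ n, fun s => ?_⟩
  obtain ⟨k, hk, hk'⟩ := hp (u (s / q ^ n / q ^ n0 + 1)) (u 0)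
  set b := s / q ^ n / q ^ n0 + 1 with hb
  set t := b * q ^ n0 + k with ht
  have hut : u t = u 0 := by rw [ht, fix_block hq ξ u hufix n0 b k hk]; exact hk'
  have key : ∀ j, j < q ^ n → u (t * q ^ n + j) = u j := by
    intro j hj
    rw [fix_block hq ξ u hufix n t j hj, hut, ← fix_block hq ξ u hufix n 0 j hj]; simp
  have hQ : 0 < q ^ n := by positivity
  have hQ0 : 0 < q ^ n0 := by positivity
  have ha1 := Nat.div_add_mod s (q ^ n)
  have ha2 := Nat.mod_lt s hQ
  have hb1 := Nat.div_add_mod (s / q ^ n) (q ^ n0)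
  have hb2 := Nat.mod_lt (s / q ^ n) hQ0
  have ha3 := Nat.zero_le (s % q ^ n)
  have hb3 := Nat.zero_le (s / q ^ n % q ^ n0)
  generalize s % q ^ n = x1 at *
  generalize s / q ^ n % q ^ n0 = x2 at *
  have hbq : b * q ^ n0 = q ^ n0 * (s / q ^ n / q ^ n0) + q ^ n0 := by rw [hb]; ring
  have l1 : s / q ^ n + 1 ≤ t := by
    rw [ht, hbq]; omega
  have l2 : t ≤ s / q ^ n + 2 * q ^ n0 := by
    rw [ht, hbq]; omega
  clear_value t b
  refine ⟨t * q ^ n + i0, ?_, ?_, key _ (by omega), ?_⟩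
  · have := Nat.mul_le_mul_right (q ^ n) l1
    rw [add_mul, mul_comm] at this
    omega
  · have := Nat.mul_le_mul_right (q ^ n) l2
    rw [add_mul, mul_comm (_ / _)] at this
    rw [add_mul]
    omega
  · rw [add_assoc]; exact key _ hlt

theorem letter_occurs {A : Type*} {q : ℕ} (hq : 0 < q)
    (ξ : A → Fin q → A) (hprim : IsPrimitiveSubst hq ξ) (u : ℕ → A)
    (hufix : substApply hq ξ u = u) (a : A) : ∃ i, u i = a := by
  obtain ⟨n, _, hp⟩ := hprim
  obtain ⟨k, hk, hk'⟩ := hp (u 0) a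
  exact ⟨0 * q ^ n + k, by rw [fix_block hq ξ u hufix n 0 k hk]; exact hk'⟩

/-- basic properties of the height -/
theorem height_spec {A : Type*} {q : ℕ} (hq : 0 < q) (h2 : 2 ≤ q)
    (ξ : A → Fin q → A) (hprim : IsPrimitiveSubst hq ξ) (u : ℕ → A)
    (hufix : substApply hq ξ u = u) :
    0 < substHeight hq ξ u ∧ Nat.Coprime (substHeight hq ξ u) q ∧
    (∀ n : ℕ, u n = u 0 → substHeight hq ξ u ∣ n) ∧
    (∀ k : ℕ, Nat.Coprime k q → (∀ n : ℕ, u n = u 0 → k ∣ n) → k ∣ substHeight hq ξ u) ∧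
    ∃ n, 0 < n ∧ u n = u 0 := by
  obtain ⟨K, hK⟩ := syndetic hq h2 ξ hprim u hufix 0 0
  obtain ⟨t, ht, -, hut, -⟩ := hK 1
  set S := {k : ℕ | Nat.Coprime k q ∧ ∀ n : ℕ, u n = u 0 → k ∣ n} with hS
  have hbdd : BddAbove S := ⟨t, fun k hk => Nat.le_of_dvd (by omega) (hk.2 t hut)⟩
  have h1 : 1 ∈ S := ⟨Nat.coprime_one_left q, fun n _ => one_dvd n⟩
  have hmem : substHeight hq ξ u ∈ S := Nat.sSup_mem ⟨1, h1⟩ hbdd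
  have hle : ∀ k ∈ S, k ≤ substHeight hq ξ u := fun k hk => le_csSup hbdd hk
  have hpos : 0 < substHeight hq ξ u := hle 1 h1
  refine ⟨hpos, hmem.1, hmem.2, fun k hk hk' => ?_, t, by omega, hut⟩
  have hl : Nat.lcm k (substHeight hq ξ u) ∈ S := by
    refine ⟨?_, fun n hn => Nat.lcm_dvd (hk' n hn) (hmem.2 n hn)⟩
    exact Nat.Coprime.of_dvd_left (Nat.lcm_dvd_mul _ _) (Nat.Coprime.mul_left hk hmem.1)
  have := hle _ hl
  have h3 := Nat.dvd_lcm_right k (substHeight hq ξ u)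
  have h4 : Nat.lcm k (substHeight hq ξ u) = substHeight hq ξ u :=
    le_antisymm this (Nat.le_of_dvd (Nat.pos_of_ne_zero (by
      intro h0; rw [Nat.lcm_eq_zero_iff] at h0; rcases h0 with h0 | h0
      · rw [h0] at hk'; have := hk' t hut; rw [zero_dvd_iff] at this; omega
      · omega)) h3)
  rw [← h4]; exact Nat.dvd_lcm_left _ _

theorem color_wd {A : Type*} {q : ℕ} (hq : 0 < q) (h2 : 2 ≤ q)
    (ξ : A → Fin q → A) (hprim : IsPrimitiveSubst hq ξ) (u : ℕ → A)
    (hufix : substApply hq ξ u = u) (i j : ℕ) (hij : u i = u j) :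
    i ≡ j [MOD substHeight hq ξ u] := by
  obtain ⟨hpos, hco, hd, -, -⟩ := height_spec hq h2 ξ hprim u hufix
  obtain ⟨n, _, hp⟩ := hprim
  obtain ⟨k, hk, hk'⟩ := hp (u i) (u 0)
  have e1 : u (i * q ^ n + k) = u 0 := by rw [fix_block hq ξ u hufix n i k hk]; exact hk'
  have e2 : u (j * q ^ n + k) = u 0 := by rw [fix_block hq ξ u hufix n j k hk, ← hij]; exact hk'
  have h3 : i * q ^ n + k ≡ j * q ^ n + k [MOD substHeight hq ξ u] :=
    ((Nat.modEq_zero_iff_dvd).2 (hd _ e1)).trans ((Nat.modEq_zero_iff_dvd).2 (hd _ e2)).symm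
  exact Nat.ModEq.cancel_right_of_coprime (Nat.Coprime.pow_right n hco) (Nat.ModEq.add_right_cancel' k h3)

theorem col_spec {A : Type*} [Fintype A] [DecidableEq A] {q : ℕ} (hq : 0 < q)
    (ξ : A → Fin q → A) :
    (∃ n k, 0 < n ∧ k < q ^ n ∧ (Finset.univ.image (colMap hq ξ n k)).card = substColumnNumber hq ξ) ∧
    ∀ n k, 0 < n → k < q ^ n → substColumnNumber hq ξ ≤ (Finset.univ.image (colMap hq ξ n k)).card := by
  constructor
  · have := Nat.sInf_mem (s := {m : ℕ | ∃ n : ℕ, 0 < n ∧ ∃ k : ℕ, k < q ^ n ∧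
      m = (Finset.univ.image fun a : A => (substApply hq ξ)^[n] (fun _ => a) k).card})
      ⟨_, 1, one_pos, 0, by positivity, rfl⟩
    obtain ⟨n, hn, k, hk, h⟩ := this
    exact ⟨n, k, hn, hk, h.symm⟩
  · intro n k hn hk
    exact Nat.sInf_le ⟨n, hn, k, hk, rfl⟩

theorem height_le_card {A : Type*} [Fintype A] [DecidableEq A] {q : ℕ} (hq : 0 < q) (h2 : 2 ≤ q)
    (ξ : A → Fin q → A) (hprim : IsPrimitiveSubst hq ξ) (u : ℕ → A)
    (hufix : substApply hq ξ u = u) (n k : ℕ) (hk : k < q ^ n) :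
    substHeight hq ξ u ≤ (Finset.univ.image (colMap hq ξ n k)).card := by
  obtain ⟨hpos, hco, -⟩ := height_spec hq h2 ξ hprim u hufix
  have := Finset.card_le_card_of_injOn (s := Finset.range (substHeight hq ξ u))
    (t := Finset.univ.image (colMap hq ξ n k)) (fun i => colMap hq ξ n k (u i))
    (fun i _ => by simp) (by
      intro i hi j hj hij
      simp only at hij
      rw [← fix_block hq ξ u hufix n i k hk, ← fix_block hq ξ u hufix n j k hk] at hij
      have h3 := color_wd hq h2 ξ hprim u hufix _ _ hij
      have h4 := Nat.ModEq.cancel_right_of_coprime (Nat.Coprime.pow_right n hco)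
        (Nat.ModEq.add_right_cancel' k h3)
      exact Nat.ModEq.eq_of_lt_of_lt h4 (by simpa using hi) (by simpa using hj))
  simpa using this

theorem height_le_col {A : Type*} [Fintype A] [DecidableEq A] {q : ℕ} (hq : 0 < q) (h2 : 2 ≤ q)
    (ξ : A → Fin q → A) (hprim : IsPrimitiveSubst hq ξ) (u : ℕ → A)
    (hufix : substApply hq ξ u = u) : substHeight hq ξ u ≤ substColumnNumber hq ξ := by
  obtain ⟨⟨n, k, -, hk, h⟩, -⟩ := col_spec hq ξ
  rw [← h]; exact height_le_card hq h2 ξ hprim u hufix n k hk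

/-- If the height is smaller than the column number, there is a bad pair. -/
theorem exists_bad_pair {A : Type*} [Fintype A] [DecidableEq A] {q : ℕ} (hq : 0 < q) (h2 : 2 ≤ q)
    (ξ : A → Fin q → A) (hprim : IsPrimitiveSubst hq ξ) (u : ℕ → A)
    (hufix : substApply hq ξ u = u) (hlt : substHeight hq ξ u < substColumnNumber hq ξ) :
    ∃ i m : ℕ, substHeight hq ξ u ∣ m ∧
      ∀ n j, j < q ^ n → colMap hq ξ n j (u i) ≠ colMap hq ξ n j (u (i + m)) := by
  obtain ⟨hpos, -⟩ := height_spec hq h2 ξ hprim u hufix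
  obtain ⟨⟨n0, k0, hn0, hk0, hc⟩, hmin⟩ := col_spec hq ξ
  choose p hp using letter_occurs hq ξ hprim u hufix
  obtain ⟨a, ha, b, hb, hab, hcol⟩ := Finset.exists_ne_map_eq_of_card_lt_of_maps_to
    (s := Finset.univ.image (colMap hq ξ n0 k0)) (t := Finset.range (substHeight hq ξ u))
    (f := fun a => p a % substHeight hq ξ u) (by simpa [hc] using hlt)
    (fun a _ => by simpa using Nat.mod_lt _ hpos)
  have hne : ∀ n j, j < q ^ n → colMap hq ξ n j a ≠ colMap hq ξ n j b := by
    intro n j hj heq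
    have h3 := hmin (n + n0) (k0 * q ^ n + j) (by omega) (by
      rw [pow_add]
      calc k0 * q ^ n + j < k0 * q ^ n + q ^ n := by omega
        _ = (k0 + 1) * q ^ n := by ring
        _ ≤ q ^ n0 * q ^ n := Nat.mul_le_mul_right _ hk0
        _ = _ := mul_comm _ _)
    have h4 : Finset.univ.image (colMap hq ξ (n + n0) (k0 * q ^ n + j)) =
        (Finset.univ.image (colMap hq ξ n0 k0)).image (colMap hq ξ n j) := by
      rw [Finset.image_image]
      congr 1
      funext x
      exact colMap_add hq ξ n n0 k0 j x hj
    rw [h4, ← hc] at h3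
    have h5 := Finset.card_image_iff.1 (le_antisymm Finset.card_image_le h3)
    exact hab (h5 (by simpa using ha) (by simpa using hb) heq)
  rcases le_total (p a) (p b) with hle | hle
  · refine ⟨p a, p b - p a, (Nat.modEq_iff_dvd' hle).1 hcol, fun n j hj => ?_⟩
    rw [Nat.add_sub_cancel' hle, hp, hp]; exact hne n j hj
  · refine ⟨p b, p a - p b, (Nat.modEq_iff_dvd' hle).1 hcol.symm, fun n j hj => ?_⟩
    rw [Nat.add_sub_cancel' hle, hp, hp]; exact (hne n j hj).symm

theorem coprime_part (q : ℕ) : ∀ g : ℕ, 0 < g →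
    ∃ g1 s : ℕ, Nat.Coprime g1 q ∧ g1 ∣ g ∧ g ∣ g1 * q ^ s := by
  intro g
  induction g using Nat.strong_induction_on with
  | _ g ih =>
    intro hg
    by_cases hc : Nat.Coprime g q
    · exact ⟨g, 0, hc, dvd_rfl, by simp⟩
    · have hd0 : 0 < Nat.gcd g q := Nat.gcd_pos_of_pos_left _ hg
      have hd : 2 ≤ Nat.gcd g q := by
        have : Nat.gcd g q ≠ 1 := hc
        omega
      have hdg := Nat.gcd_dvd_left g q
      obtain ⟨g1, s, c1, c2, c3⟩ := ih (g / Nat.gcd g q) (Nat.div_lt_self hg hd)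
        (Nat.div_pos (Nat.le_of_dvd hg hdg) hd0)
      refine ⟨g1, s + 1, c1, c2.trans (Nat.div_dvd_of_dvd hdg), ?_⟩
      have := Nat.mul_dvd_mul c3 (Nat.gcd_dvd_right g q)
      rw [Nat.div_mul_cancel hdg] at this
      rwa [pow_succ, ← mul_assoc]

/-- Toeplitz structure when the column number equals the height. -/
theorem good_columns {A : Type*} [Fintype A] [DecidableEq A] {q : ℕ} (hq : 0 < q) (h2 : 2 ≤ q)
    (ξ : A → Fin q → A) (hprim : IsPrimitiveSubst hq ξ) (u : ℕ → A)
    (hufix : substApply hq ξ u = u) (hc : substColumnNumber hq ξ = substHeight hq ξ u) :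
    ∃ n0 : ℕ, 0 < n0 ∧ ∀ k : ℕ, ∃ B : Finset ℕ, B.card ≤ (q ^ n0 - 1) ^ k ∧
      ∀ j < q ^ (n0 * k), j ∉ B → ∀ i i', i ≡ i' [MOD substHeight hq ξ u] →
        u (i * q ^ (n0 * k) + j) = u (i' * q ^ (n0 * k) + j) := by
  obtain ⟨hpos, hco, -⟩ := height_spec hq h2 ξ hprim u hufix
  obtain ⟨⟨n0, k0, hn0, hk0, hcc⟩, -⟩ := col_spec hq ξ
  have hk0col : ∀ i i', i ≡ i' [MOD substHeight hq ξ u] →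
      u (i * q ^ n0 + k0) = u (i' * q ^ n0 + k0) := by
    have hsurj := Finset.surj_on_of_inj_on_of_card_le (s := Finset.range (substHeight hq ξ u))
      (t := Finset.univ.image (colMap hq ξ n0 k0)) (fun i _ => colMap hq ξ n0 k0 (u i))
      (fun i _ => by simp) (by
        intro i j hi hj hij
        rw [← fix_block hq ξ u hufix n0 i k0 hk0, ← fix_block hq ξ u hufix n0 j k0 hk0] at hij
        have h3 := color_wd hq h2 ξ hprim u hufix _ _ hij
        have h4 := Nat.ModEq.cancel_right_of_coprime (Nat.Coprime.pow_right n0 hco)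
          (Nat.ModEq.add_right_cancel' k0 h3)
        exact Nat.ModEq.eq_of_lt_of_lt h4 (by simpa using hi) (by simpa using hj))
      (by rw [hcc, hc]; simp)
    have hmod : ∀ i, ∃ r < substHeight hq ξ u, r ≡ i [MOD substHeight hq ξ u] ∧
        u (i * q ^ n0 + k0) = u (r * q ^ n0 + k0) := by
      intro i
      obtain ⟨r, hr, hri⟩ := hsurj (colMap hq ξ n0 k0 (u i)) (by simp)
      rw [← fix_block hq ξ u hufix n0 i k0 hk0, ← fix_block hq ξ u hufix n0 r k0 hk0] at hri
      have h3 := color_wd hq h2 ξ hprim u hufix _ _ hri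
      exact ⟨r, by simpa using hr, (Nat.ModEq.cancel_right_of_coprime (Nat.Coprime.pow_right n0 hco)
          (Nat.ModEq.add_right_cancel' k0 h3)).symm, hri⟩
    intro i i' hii
    obtain ⟨r, hr, hr1, hr2⟩ := hmod i
    obtain ⟨r', hr', hr1', hr2'⟩ := hmod i'
    have : r = r' := Nat.ModEq.eq_of_lt_of_lt ((hr1.trans hii).trans hr1'.symm) hr hr'
    rw [hr2, hr2', this]
  refine ⟨n0, hn0, fun k => ?_⟩
  have hQ : 0 < q ^ n0 := by positivity
  induction k with
  | zero =>
    refine ⟨{0}, by simp, fun j hj hj' => ?_⟩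
    simp at hj hj'
    exact absurd hj hj'
  | succ k ih =>
    obtain ⟨B, hB, hgood⟩ := ih
    refine ⟨(B ×ˢ ((Finset.range (q ^ n0)).erase k0)).image (fun p => p.1 * q ^ n0 + p.2), ?_, ?_⟩
    · refine Finset.card_image_le.trans ?_
      rw [Finset.card_product, Finset.card_erase_of_mem (by simpa using hk0), Finset.card_range,
        pow_succ]
      exact Nat.mul_le_mul_right _ hB
    · intro j hj hjB i i' hii
      have hj1 : j / q ^ n0 < q ^ (n0 * k) := by
        rw [Nat.div_lt_iff_lt_mul hQ, ← pow_add]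
        rwa [mul_add, mul_one] at hj
      have hj2 := Nat.mod_lt j hQ
      have hj3 : j / q ^ n0 * q ^ n0 + j % q ^ n0 = j := Nat.div_add_mod' j _
      have hrep : ∀ x, x * q ^ (n0 * (k + 1)) + j =
          (x * q ^ (n0 * k) + j / q ^ n0) * q ^ n0 + j % q ^ n0 := by
        intro x
        conv_lhs => rw [← hj3]
        rw [mul_add, mul_one, pow_add]; ring
      rw [hrep i, hrep i']
      by_cases hb : j / q ^ n0 ∈ B
      · have hk : j % q ^ n0 = k0 := by
          by_contra hne
          apply hjB
          rw [Finset.mem_image]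
          exact ⟨(j / q ^ n0, j % q ^ n0), by simp [hb, hne, hj2], hj3⟩
        rw [hk]
        exact hk0col _ _ (Nat.ModEq.add_right _ (Nat.ModEq.mul_right _ hii))
      · rw [fix_block hq ξ u hufix n0 _ _ hj2, fix_block hq ξ u hufix n0 _ _ hj2,
          hgood _ hj1 hb i i' hii]

section HilbertPart

variable {H : Type*} [NormedAddCommGroup H] [InnerProductSpace ℂ H]

theorem orthonormal_countable [TopologicalSpace.SeparableSpace H] {ι : Type*} {v : ι → H}
    (hv : Orthonormal ℂ v) : Countable ι := by
  refine Pairwise.countable_of_isOpen_disjoint (s := fun i => Metric.ball (v i) (1 / 2)) ?_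
    (fun i => Metric.isOpen_ball) (fun i => ⟨v i, by simp⟩)
  intro i j hij
  refine Metric.ball_disjoint_ball ?_
  have h1 : ‖v i - v j‖ * ‖v i - v j‖ = 2 := by
    rw [@norm_sub_mul_self ℂ, hv.2 hij, hv.1 i, hv.1 j]; norm_num
  rw [dist_eq_norm]
  nlinarith [norm_nonneg (v i - v j)]

theorem eigen_norm_one (U : H →ₗᵢ[ℂ] H) {c : ℂ} {x : H} (hx : x ≠ 0) (h : U x = c • x) :
    ‖c‖ = 1 := by
  have h1 := U.norm_map x
  rw [h, norm_smul] at h1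
  have h2 : ‖x‖ ≠ 0 := norm_ne_zero_iff.2 hx
  exact mul_right_cancel₀ h2 (by rw [h1, one_mul])

theorem eigen_orthogonal (U : H →ₗᵢ[ℂ] H) {c d : ℂ} (hcd : c ≠ d) {x y : H}
    (hx : U x = c • x) (hy : U y = d • y) : inner ℂ x y = 0 := by
  by_cases hx0 : x = 0
  · simp [hx0]
  by_cases hy0 : y = 0
  · simp [hy0]
  have hc := eigen_norm_one U hx0 hx
  have hd := eigen_norm_one U hy0 hy
  have h1 := U.inner_map_map x y
  rw [hx, hy, inner_smul_left, inner_smul_right] at h1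
  by_contra hne
  have h2 : (starRingEnd ℂ) c * d = 1 :=
    mul_right_cancel₀ hne (by rw [mul_assoc, h1, one_mul])
  have h3 : c * (starRingEnd ℂ) c = 1 := by
    rw [Complex.mul_conj, Complex.normSq_eq_norm_sq, hc]; simp
  apply hcd
  calc c = c * ((starRingEnd ℂ) c * d) := by rw [h2, mul_one]
    _ = d := by rw [← mul_assoc, h3, one_mul]

/-- span of all eigenvectors -/
def eigSpan (U : H →ₗᵢ[ℂ] H) : Submodule ℂ H :=
  Submodule.span ℂ {x | ∃ c : ℂ, U x = c • x}

theorem exists_eigenbasis [CompleteSpace H] [TopologicalSpace.SeparableSpace H] (U : H →ₗᵢ[ℂ] H)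
    (hd : ∀ f : H, f ∈ closure (eigSpan U : Set H)) :
    ∃ (ι : Type) (b : HilbertBasis ι ℂ H), ∀ i, ∃ c : ℂ, U (b i) = c • b i := by
  set V : ℂ → Submodule ℂ H := fun c => LinearMap.ker ((U.toContinuousLinearMap - c • (1 : H →L[ℂ] H)) : H →L[ℂ] H).toLinearMap with hV
  have hmem : ∀ c x, x ∈ V c ↔ U x = c • x := by
    intro c x
    simp [hV, LinearMap.mem_ker, sub_eq_zero]
  have hcl : ∀ c, IsClosed (V c : Set H) := fun c =>
    ContinuousLinearMap.isClosed_ker (U.toContinuousLinearMap - c • (1 : H →L[ℂ] H))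
  have : ∀ c, CompleteSpace (V c) := fun c => (hcl c).completeSpace_coe
  have hor : OrthogonalFamily ℂ (fun c => V c) (fun c => (V c).subtypeₗᵢ) := by
    intro c d hcd x y
    exact eigen_orthogonal U hcd ((hmem c _).1 x.2) ((hmem d _).1 y.2)
  have hex : ∀ c, ∃ (w : Set (V c)) (b : HilbertBasis w ℂ (V c)), ⇑b = ((↑) : w → V c) :=
    fun c => exists_hilbertBasis ℂ (V c)
  choose w b hb using hex
  have hon : Orthonormal ℂ (fun a : Σ c, w c => ((b a.1 a.2 : V a.1) : H)) :=
    hor.orthonormal_sigma_orthonormal (fun c => (b c).orthonormal)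
  have := orthonormal_countable hon
  set e := (equivShrink.{0} (Σ c, w c)).symm with he
  set v : Shrink.{0} (Σ c, w c) → H := fun i => ((b (e i).1 (e i).2 : V (e i).1) : H) with hv
  have hon' : Orthonormal ℂ v := hon.comp e e.injective
  have hperp : (Submodule.span ℂ (Set.range v))ᗮ = ⊥ := by
    rw [Submodule.eq_bot_iff]
    intro x hx
    have h1 : ∀ c (i : w c), inner ℂ ((b c i : V c) : H) x = 0 := by
      intro c i
      rw [Submodule.mem_orthogonal] at hx
      refine hx _ (Submodule.subset_span ⟨e.symm ⟨c, i⟩, ?_⟩)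
      simp only [hv]
      rw [e.apply_symm_apply]
    have h2 : ∀ c, ∀ y ∈ V c, inner ℂ y x = 0 := by
      intro c y hy
      have hz : (V c).orthogonalProjectionOnto x = 0 := by
        have : ∀ i, inner ℂ (b c i) ((V c).orthogonalProjectionOnto x) = 0 := by
          intro i
          rw [Submodule.inner_orthogonalProjectionOnto_eq_of_mem_left]
          exact h1 c i
        apply (b c).repr.injective
        ext i
        rw [(b c).repr_apply_apply, this i]
        simp
      have := Submodule.inner_orthogonalProjectionOnto_eq_of_mem_left (K := V c) ⟨y, hy⟩ x
      rw [hz] at this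
      simpa using this.symm
    have h3 : ∀ y ∈ eigSpan U, inner ℂ y x = 0 := by
      intro y hy
      have : x ∈ (eigSpan U)ᗮ := by
        unfold eigSpan
        rw [Submodule.mem_orthogonal]
        intro z hz
        induction hz using Submodule.span_induction with
        | mem z hz => obtain ⟨c, hc⟩ := hz; exact h2 c z ((hmem c z).2 hc)
        | zero => simp
        | add a b _ _ ha hb => rw [inner_add_left, ha, hb, add_zero]
        | smul a z _ hz => rw [inner_smul_left, hz, mul_zero]
      exact (Submodule.mem_orthogonal _ _).1 this y hy
    have h4 : ∀ y ∈ closure (eigSpan U : Set H), inner ℂ y x = 0 := by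
      intro y hy
      have hc : IsClosed {y : H | inner ℂ y x = (0 : ℂ)} :=
        isClosed_eq (by fun_prop) continuous_const
      exact closure_minimal (fun y hy => h3 y hy) hc hy
    exact inner_self_eq_zero.1 (h4 x (hd x))
  refine ⟨_, HilbertBasis.mkOfOrthogonalEqBot hon' hperp, fun i => ⟨(e i).1, ?_⟩⟩
  rw [HilbertBasis.coe_mkOfOrthogonalEqBot]
  exact (hmem _ _).1 (b (e i).1 (e i).2).2

theorem fixed_mem_eigSpan (U : H →ₗᵢ[ℂ] H) (r : ℕ) (hr : 0 < r) (x : H) (hx : U^[r] x = x) :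
    x ∈ eigSpan U := by
  obtain ⟨ζ, hζ⟩ : ∃ ζ : ℂ, IsPrimitiveRoot ζ r := ⟨_, Complex.isPrimitiveRoot_exp r hr.ne'⟩
  set y : ℕ → H := fun j => ∑ k ∈ Finset.range r, (ζ ^ j) ^ k • U^[k] x with hy
  have hz0 : ζ ≠ 0 := hζ.ne_zero hr.ne'
  have hyeig : ∀ j, y j ∈ eigSpan U := by
    intro j
    refine Submodule.subset_span ⟨(ζ ^ j)⁻¹, ?_⟩
    rw [eq_inv_smul_iff₀ (pow_ne_zero _ hz0)]
    simp only [hy, map_sum, map_smul, Finset.smul_sum, smul_smul]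
    have h1 : ∀ k ∈ Finset.range r, (ζ ^ j * (ζ ^ j) ^ k) • U (U^[k] x) =
        (fun k => (ζ ^ j) ^ k • U^[k] x) (k + 1) := by
      intro k _
      simp only [Function.iterate_succ_apply']
      rw [pow_succ']
    rw [Finset.sum_congr rfl h1]
    have h2 := Finset.sum_range_succ' (fun k => (ζ ^ j) ^ k • U^[k] x) r
    rw [Finset.sum_range_succ] at h2
    have h3 : (ζ ^ j) ^ r • U^[r] x = (ζ ^ j) ^ 0 • U^[0] x := by
      rw [hx, ← pow_mul, mul_comm, pow_mul, hζ.pow_eq_one]; simp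
    rw [h3] at h2
    exact Eq.symm <| add_right_cancel h2
  have hsum : ∑ j ∈ Finset.range r, y j = (r : ℂ) • x := by
    simp only [hy]
    rw [Finset.sum_comm]
    simp_rw [← Finset.sum_smul]
    rw [Finset.sum_eq_single 0]
    · simp
    · intro k hk hk0
      have : ∑ j ∈ Finset.range r, (ζ ^ j) ^ k = 0 := by
        have h1 : ζ ^ k ≠ 1 := hζ.pow_ne_one_of_pos_of_lt hk0 (by simpa using hk)
        have h2 := geom_sum_eq h1 r
        rw [← pow_mul, mul_comm k r, pow_mul, hζ.pow_eq_one, one_pow, sub_self, zero_div] at h2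
        rw [← h2]
        refine Finset.sum_congr rfl fun j _ => ?_
        rw [← pow_mul, ← pow_mul, mul_comm]
      rw [this, zero_smul]
    · intro h; simp at h; omega
  have : x = (r : ℂ)⁻¹ • ∑ j ∈ Finset.range r, y j := by
    rw [hsum, smul_smul, inv_mul_cancel₀ (by exact_mod_cast hr.ne'), one_smul]
  rw [this]
  exact Submodule.smul_mem _ _ (Submodule.sum_mem _ fun j _ => hyeig j)

theorem mem_closure_eigSpan [CompleteSpace H] (U : H →ₗᵢ[ℂ] H) (f : H)
    (hf : ∀ ε : ℝ, 0 < ε → ∃ r : ℕ, 0 < r ∧ ∀ n : ℕ, ‖U^[r * n] f - f‖ ≤ ε) :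
    f ∈ closure (eigSpan U : Set H) := by
  rw [Metric.mem_closure_iff]
  intro ε hε
  obtain ⟨r, hr, hrn⟩ := hf (ε / 2) (by positivity)
  set V : H →L[ℂ] H := U.toContinuousLinearMap ^ r with hV
  have hVit : ∀ (n : ℕ) (x : H), V^[n] x = U^[r * n] x := by
    intro n x
    have : (V : H → H) = U^[r] := by
      rw [hV]; funext x; rw [FunLike.coe_pow_eq_iterate]; rfl
    rw [this, ← Function.iterate_mul]
  have hV1 : ‖V‖ ≤ 1 := by
    refine ContinuousLinearMap.opNorm_le_bound _ zero_le_one fun x => ?_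
    have h1 := hVit 1 x
    simp only [Function.iterate_one, mul_one] at h1
    have h2 : ∀ n (x : H), ‖U^[n] x‖ = ‖x‖ := by
      intro n
      induction n with
      | zero => intro x; rfl
      | succ n ih => intro x; rw [Function.iterate_succ_apply', U.norm_map, ih]
    rw [h1, h2, one_mul]
  have hlim := V.tendsto_birkhoffAverage_orthogonalProjection hV1 f
  set p := (V.eqLocus (1 : H →L[ℂ] H)).orthogonalProjectionOnto f with hp
  refine ⟨p, ?_, ?_⟩
  · have hpm : V (p : H) = p := p.2
    have := hVit 1 p
    simp only [Function.iterate_one, mul_one] at this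
    exact fixed_mem_eigSpan U r hr _ (this.symm.trans hpm)
  · have : ‖(p : H) - f‖ ≤ ε / 2 := by
      refine le_of_tendsto (hlim.sub_const f).norm ?_
      filter_upwards [Filter.eventually_gt_atTop 0] with N hN
      have hN' : (N : ℂ) ≠ 0 := by exact_mod_cast hN.ne'
      have : birkhoffAverage ℂ V _root_.id N f - f =
          (N : ℂ)⁻¹ • ∑ n ∈ Finset.range N, (U^[r * n] f - f) := by
        rw [birkhoffAverage, birkhoffSum, Finset.sum_sub_distrib, smul_sub]
        simp only [id, hVit, Finset.sum_const, Finset.card_range]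
        rw [← Nat.cast_smul_eq_nsmul ℂ, smul_smul, inv_mul_cancel₀ hN', one_smul]
      rw [this, norm_smul, norm_inv, Complex.norm_natCast, inv_mul_le_iff₀ (by exact_mod_cast hN)]
      calc _ ≤ ∑ n ∈ Finset.range N, ‖U^[r * n] f - f‖ := norm_sum_le _ _
        _ ≤ ∑ n ∈ Finset.range N, ε / 2 := Finset.sum_le_sum fun n _ => hrn n
        _ = _ := by simp
    rw [dist_comm, dist_eq_norm]; linarith

theorem tendsto_of_eigenbasis (U : H →ₗᵢ[ℂ] H) {ι : Type*} (b : HilbertBasis ι ℂ H)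
    (M : ℕ → ℕ) (hb : ∀ i, ∃ c : ℂ, U (b i) = c • b i ∧ Tendsto (fun n => c ^ M n) atTop (nhds 1))
    (f : H) : Tendsto (fun n => ‖U^[M n] f - f‖) atTop (nhds 0) := by
  have hpow : ∀ n, ((U.toContinuousLinearMap ^ n : H →L[ℂ] H) : H → H) = U^[n] := by
    intro n
    rw [FunLike.coe_pow_eq_iterate]; rfl
  have hn : ∀ n (x : H), ‖U^[n] x‖ = ‖x‖ := by
    intro n
    induction n with
    | zero => intro x; rfl
    | succ n ih => intro x; rw [Function.iterate_succ_apply', U.norm_map, ih]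
  have hspan : ∀ g ∈ Submodule.span ℂ (Set.range b),
      Tendsto (fun n => U^[M n] g - g) atTop (nhds 0) := by
    intro g hg
    induction hg using Submodule.span_induction with
    | mem g hg =>
      obtain ⟨i, rfl⟩ := hg
      obtain ⟨c, hc, ht⟩ := hb i
      have hit : ∀ n, U^[n] (b i) = c ^ n • b i := by
        intro n
        induction n with
        | zero => simp
        | succ n ih => rw [Function.iterate_succ_apply', ih, map_smul, hc, smul_smul, pow_succ]
      simp only [hit]
      have := (ht.smul_const (b i)).sub_const (b i)
      simpa using this
    | zero => simp only [← hpow, map_zero, sub_zero]; exact tendsto_const_nhds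
    | add x y _ _ hx hy =>
      have := hx.add hy
      rw [add_zero] at this
      refine this.congr fun n => ?_
      simp only [← hpow, map_add]; abel
    | smul a x _ hx =>
      have := hx.const_smul a
      rw [smul_zero] at this
      refine this.congr fun n => ?_
      simp only [← hpow, map_smul, smul_sub]
  rw [Metric.tendsto_atTop]
  intro ε hε
  have hmem : f ∈ (Submodule.span ℂ (Set.range b)).topologicalClosure := by
    rw [b.dense_span]; trivial
  obtain ⟨g, hg, hfg⟩ := Metric.mem_closure_iff.1 hmem (ε / 3) (by positivity)
  obtain ⟨N, hN⟩ := Metric.tendsto_atTop.1 (hspan g hg) (ε / 3) (by positivity)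
  refine ⟨N, fun n hn' => ?_⟩
  have h1 := hN n hn'
  rw [dist_zero_right] at h1
  rw [dist_zero_right, norm_norm]
  rw [dist_eq_norm] at hfg
  have h2 : U^[M n] f - f = U^[M n] (f - g) + (U^[M n] g - g) - (f - g) := by
    simp only [← hpow, map_sub]; abel
  rw [h2]
  have h3 := hn (M n) (f - g)
  calc _ ≤ ‖U^[M n] (f - g) + (U^[M n] g - g)‖ + ‖f - g‖ := norm_sub_le _ _
    _ ≤ ‖U^[M n] (f - g)‖ + ‖U^[M n] g - g‖ + ‖f - g‖ := by gcongr; exact norm_add_le _ _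
    _ < ε := by rw [h3]; linarith

end HilbertPart

/-- If `λ^(q^n m) → 1` for all return times `m`, then also for the multiples of the height. -/
theorem eigenvalue_tendsto {A : Type*} {q : ℕ} (hq : 0 < q) (h2 : 2 ≤ q)
    (ξ : A → Fin q → A) (hprim : IsPrimitiveSubst hq ξ) (u : ℕ → A)
    (hufix : substApply hq ξ u = u) (c : ℂ) (hc : ‖c‖ = 1)
    (hret : ∀ m, u m = u 0 → Tendsto (fun n : ℕ => c ^ (q ^ n * m)) atTop (nhds 1))
    (m : ℕ) (hm : substHeight hq ξ u ∣ m) :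
    Tendsto (fun n : ℕ => c ^ (q ^ n * m)) atTop (nhds 1) := by
  have hc0 : c ≠ 0 := by intro h; simp [h] at hc
  obtain ⟨hpos, hco, hd, hmax, t, ht, hut⟩ := height_spec hq h2 ξ hprim u hufix
  set S : AddSubgroup ℤ :=
    { carrier := {k : ℤ | Tendsto (fun n : ℕ => c ^ ((q : ℤ) ^ n * k)) atTop (nhds 1)}
      zero_mem' := by simp
      add_mem' := by
        intro a b ha hb
        have := Filter.Tendsto.mul ha hb
        rw [one_mul] at this
        refine this.congr fun n => ?_
        rw [mul_add, zpow_add₀ hc0]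
      neg_mem' := by
        intro a ha
        have := Filter.Tendsto.inv₀ ha one_ne_zero
        rw [inv_one] at this
        refine this.congr fun n => ?_
        rw [mul_neg, zpow_neg] } with hS
  have hmemS : ∀ k : ℕ, (k : ℤ) ∈ S ↔ Tendsto (fun n : ℕ => c ^ (q ^ n * k)) atTop (nhds 1) := by
    intro k
    have : (fun n : ℕ => c ^ (q ^ n * k)) = fun n : ℕ => c ^ ((q : ℤ) ^ n * (k : ℤ)) := by
      funext n
      rw [← zpow_natCast]; push_cast; rfl
    rw [this]; rfl
  obtain ⟨a, ha⟩ := Int.subgroup_cyclic S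
  have hdvd : ∀ k : ℤ, k ∈ S ↔ a ∣ k := by
    intro k
    rw [ha, AddSubgroup.mem_closure_singleton]
    constructor
    · rintro ⟨n, rfl⟩; exact ⟨n, by simp [mul_comm]⟩
    · rintro ⟨n, rfl⟩; exact ⟨n, by simp [mul_comm]⟩
  have hdvd' : ∀ k : ℕ, (k : ℤ) ∈ S ↔ a.natAbs ∣ k := by
    intro k; rw [hdvd, Int.natCast_dvd_natCast.symm, Int.natAbs_dvd]
  have hR : ∀ k, u k = u 0 → a.natAbs ∣ k := fun k hk => (hdvd' k).1 ((hmemS k).2 (hret k hk))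
  have ha0 : 0 < a.natAbs := Nat.pos_of_dvd_of_pos (hR t hut) ht
  obtain ⟨g1, s, hg1, hg2, hg3⟩ := coprime_part q a.natAbs ha0
  have hgh : g1 ∣ substHeight hq ξ u := hmax g1 hg1 fun n hn => hg2.trans (hR n hn)
  have h3 : a.natAbs ∣ m * q ^ s := hg3.trans (Nat.mul_dvd_mul (hgh.trans hm) dvd_rfl)
  have h4 := (hmemS _).1 ((hdvd' _).2 h3)
  rw [← Filter.tendsto_add_atTop_iff_nat s]
  refine h4.congr fun n => ?_
  congr 1; rw [pow_add]; ring

theorem shift_iter {A : Type*} (n : ℕ) (x : ℕ → A) (j : ℕ) :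
    (shiftMap A)^[n] x j = x (j + n) := by
  induction n generalizing x with
  | zero => rfl
  | succ n ih => rw [Function.iterate_succ_apply, ih]; simp [shiftMap, add_assoc]

section MeasurePart

variable {A : Type*} [Fintype A] [TopologicalSpace A] [DiscreteTopology A]
    [MeasurableSpace A] [BorelSpace A]

theorem continuous_shift_iter (n : ℕ) : Continuous ((shiftMap A)^[n]) := by
  refine continuous_pi fun j => ?_
  simp only [shift_iter]
  exact continuous_apply _

theorem ae_mem_orbitClosure (u : ℕ → A) (μ : Measure (ℕ → A)) [IsProbabilityMeasure μ]
    (hμsupp : μ (substOrbitClosure A u) = 1) : ∀ᵐ x ∂μ, x ∈ substOrbitClosure A u := by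
  unfold substOrbitClosure at *
  rw [← prob_compl_eq_zero_iff (isClosed_closure.measurableSet)] at hμsupp
  exact hμsupp

theorem invariant_iter (μ : Measure (ℕ → A)) (hμinv : MeasurePreserving (shiftMap A) μ μ)
    (G : (ℕ → A) → ℝ≥0∞) (hG : ∀ᵐ x ∂μ, G (shiftMap A x) = G x) (n : ℕ) :
    ∀ᵐ x ∂μ, G ((shiftMap A)^[n] x) = G x := by
  induction n with
  | zero => simp
  | succ n ih =>
    have := (hμinv.iterate n).quasiMeasurePreserving.ae hG
    filter_upwards [ih, this] with x h1 h2
    rw [Function.iterate_succ_apply', h2, h1]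

open Classical in
theorem density_lower (u : ℕ → A) (μ : Measure (ℕ → A)) [IsProbabilityMeasure μ]
    (hμinv : MeasurePreserving (shiftMap A) μ μ)
    (hμsupp : μ (substOrbitClosure A u) = 1)
    (E : Set (ℕ → A)) (hE : IsClopen E) (N K : ℕ)
    (hcount : ∀ s, K ≤ ((Finset.range N).filter fun i => (shiftMap A)^[s + i] u ∈ E).card)
    (G : (ℕ → A) → ℝ≥0∞) (hGm : Measurable G)
    (hG : ∀ᵐ x ∂μ, G (shiftMap A x) = G x) :
    (K : ℝ≥0∞) * ∫⁻ x, G x ∂μ ≤ N * ∫⁻ x in E, G x ∂μ := by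
  have hEm : MeasurableSet E := hE.1.measurableSet
  set I : (ℕ → A) → ℝ≥0∞ := E.indicator (fun _ => 1) with hI
  have hIm : Measurable I := measurable_const.indicator hEm
  have hIc : Continuous I := continuous_const.indicator
    (fun a ha => by rw [hE.frontier_eq] at ha; exact ha.elim)
  have hS : ∀ᵐ x ∂μ, (K : ℝ≥0∞) ≤ ∑ i ∈ Finset.range N, I ((shiftMap A)^[i] x) := by
    filter_upwards [ae_mem_orbitClosure u μ hμsupp] with x hx
    have hcl : IsClosed {x : ℕ → A | (K : ℝ≥0∞) ≤ ∑ i ∈ Finset.range N, I ((shiftMap A)^[i] x)} :=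
      isClosed_le continuous_const
        (continuous_finsetSum _ fun i _ => hIc.comp (continuous_shift_iter i))
    refine closure_minimal ?_ hcl hx
    rintro _ ⟨s, rfl⟩
    have : ∑ i ∈ Finset.range N, I ((shiftMap A)^[i] ((shiftMap A)^[s] u)) =
        (((Finset.range N).filter fun i => (shiftMap A)^[s + i] u ∈ E).card : ℝ≥0∞) := by
      rw [Finset.card_filter]
      push_cast
      refine Finset.sum_congr rfl fun i _ => ?_
      rw [← Function.iterate_add_apply, add_comm i s, hI, Set.indicator_apply]
    simp only [Set.mem_ofPred_eq]
    rw [this]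
    exact_mod_cast hcount s
  calc (K : ℝ≥0∞) * ∫⁻ x, G x ∂μ = ∫⁻ x, K * G x ∂μ := (lintegral_const_mul _ hGm).symm
    _ ≤ ∫⁻ x, (∑ i ∈ Finset.range N, I ((shiftMap A)^[i] x)) * G x ∂μ := by
        refine lintegral_mono_ae ?_
        filter_upwards [hS] with x hx
        gcongr
    _ = ∑ i ∈ Finset.range N, ∫⁻ x, I ((shiftMap A)^[i] x) * G x ∂μ := by
        simp_rw [Finset.sum_mul]
        refine lintegral_finsetSum _ fun i _ => ?_
        exact (hIm.comp (continuous_shift_iter i).measurable).mul hGm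
    _ = ∑ i ∈ Finset.range N, ∫⁻ x in E, G x ∂μ := by
        refine Finset.sum_congr rfl fun i _ => ?_
        have h1 : ∫⁻ x, I ((shiftMap A)^[i] x) * G x ∂μ =
            ∫⁻ x, (fun y => I y * G y) ((shiftMap A)^[i] x) ∂μ := by
          refine lintegral_congr_ae ?_
          filter_upwards [invariant_iter μ hμinv G hG i] with x hx
          simp only [hx]
        rw [h1, (hμinv.iterate i).lintegral_comp (f := fun y => I y * G y) (hIm.mul hGm), ← lintegral_indicator hEm]
        refine lintegral_congr fun x => ?_
        by_cases hx : x ∈ E <;> simp [hI, hx]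
    _ = _ := by simp

open Classical in
/-- Density estimate from blocks. -/
theorem density_block (u : ℕ → A) (μ : Measure (ℕ → A)) [IsProbabilityMeasure μ]
    (hμinv : MeasurePreserving (shiftMap A) μ μ)
    (hμsupp : μ (substOrbitClosure A u) = 1)
    (E : Set (ℕ → A)) (hE : IsClopen E) (P : ℕ → Prop) (K L Q : ℕ) (hQ : 0 < Q)
    (hK : ∀ s, ∃ t, s ≤ t ∧ t < s + K ∧ P t)
    (hPE : ∀ t, P t → ∀ j, j + L < Q → (shiftMap A)^[t * Q + j] u ∈ E)
    (G : (ℕ → A) → ℝ≥0∞) (hGm : Measurable G)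
    (hG : ∀ᵐ x ∂μ, G (shiftMap A x) = G x) :
    ((Q - L : ℕ) : ℝ≥0∞) * ∫⁻ x, G x ∂μ ≤ ((K + 1) * Q : ℕ) * ∫⁻ x in E, G x ∂μ := by
  refine density_lower u μ hμinv hμsupp E hE _ _ (fun s => ?_) G hGm hG
  obtain ⟨t, ht1, ht2, ht⟩ := hK (s / Q + 1)
  have ha1 := Nat.div_add_mod s Q
  have ha2 := Nat.mod_lt s hQ
  have l1 : s ≤ t * Q := by
    have := Nat.mul_le_mul_right Q ht1
    rw [add_mul, mul_comm] at this
    omega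
  have l2 : t * Q + Q ≤ s + (K + 1) * Q := by
    have := Nat.mul_le_mul_right Q (Nat.succ_le_of_lt ht2)
    have e1 : (t + 1) * Q = t * Q + Q := by ring
    have e2 : (s / Q + 1 + K) * Q = Q * (s / Q) + (K + 1) * Q := by ring
    rw [Nat.succ_eq_add_one, e1, e2] at this
    omega
  have := Finset.card_le_card_of_injOn (s := Finset.range (Q - L))
    (t := (Finset.range ((K + 1) * Q)).filter fun i => (shiftMap A)^[s + i] u ∈ E)
    (fun j => t * Q + j - s) (by
      intro j hj
      have hj' : j < Q - L := by simpa using hj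
      simp only [Finset.coe_filter, Finset.mem_range, Set.mem_ofPred_eq]
      refine ⟨by omega, ?_⟩
      rw [Nat.add_sub_cancel' (by omega)]
      exact hPE t ht j (by omega)) (by
      intro j hj k hk hjk
      simp only at hjk
      omega)
  simpa using this

theorem isClopen_coord (i j : ℕ) : IsClopen {x : ℕ → A | x i = x j} := by
  have : IsClopen {p : A × A | p.1 = p.2} := isClopen_discrete _
  have hc : Continuous (fun x : ℕ → A => (x i, x j)) :=
    (continuous_apply i).prodMk (continuous_apply j)
  exact this.preimage hc

/-- Cylinder functions are dense in `L²`. -/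
theorem exists_cylinder_approx (μ : Measure (ℕ → A)) [IsProbabilityMeasure μ]
    (g : Lp ℂ 2 μ) (ε : ℝ) (hε : 0 < ε) :
    ∃ (L : ℕ) (F : (ℕ → A) → ℂ) (hF : MemLp F 2 μ), Continuous F ∧ (∃ C : ℝ, ∀ x, ‖F x‖ ≤ C) ∧
      (∀ x y : ℕ → A, (∀ j < L, x j = y j) → F x = F y) ∧ ‖g - hF.toLp F‖ < ε := by
  obtain ⟨F0, hF0⟩ : ∃ F0 : C(ℕ → A, ℂ), ‖g - ContinuousMap.toLp 2 μ ℂ F0‖ < ε / 2 := by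
    have := ContinuousMap.toLp_denseRange (α := ℕ → A) (E := ℂ) (p := 2) μ ℂ (by norm_num)
    obtain ⟨F0, h⟩ := this.exists_dist_lt g (show 0 < ε / 2 by positivity)
    exact ⟨F0, by rwa [← dist_eq_norm]⟩
  haveI hne : Nonempty (ℕ → A) := by
    by_contra h
    rw [not_nonempty_iff] at h
    have := measure_univ (μ := μ)
    rw [Set.univ_eq_empty_iff.2 h] at this
    simp at this
  obtain ⟨z⟩ := hne
  obtain ⟨L, hL⟩ : ∃ L : ℕ, ∀ x y : ℕ → A, (∀ j < L, x j = y j) → ‖F0 x - F0 y‖ ≤ ε / 4 := by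
    letI : MetricSpace (ℕ → A) := PiNat.metricSpace
    have huc : UniformContinuous F0 := CompactSpace.uniformContinuous_of_continuous F0.continuous
    obtain ⟨δ, hδ, h⟩ := Metric.uniformContinuous_iff.1 huc (ε / 4) (by positivity)
    obtain ⟨L, hL⟩ := exists_pow_lt_of_lt_one hδ (show (1 / 2 : ℝ) < 1 by norm_num)
    refine ⟨L, fun x y hxy => ?_⟩
    have h1 : dist x y ≤ (1 / 2) ^ L := PiNat.mem_cylinder_iff_dist_le.1 hxy
    have := h (lt_of_le_of_lt h1 hL)
    rw [dist_eq_norm] at this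
    exact this.le
  set tr : (ℕ → A) → (ℕ → A) := fun x n => if n < L then x n else z n with htr
  have htrc : Continuous tr := by
    refine continuous_pi fun n => ?_
    by_cases hn : n < L
    · simp only [htr, hn, if_true]; exact continuous_apply n
    · simp only [htr, hn, if_false]; exact continuous_const
  set F1 : C(ℕ → A, ℂ) := ⟨fun x => F0 (tr x), F0.continuous.comp htrc⟩ with hF1
  have hbd : ‖F0 - F1‖ ≤ ε / 4 := by
    rw [ContinuousMap.norm_le _ (by positivity)]
    intro x
    exact hL x (tr x) fun j hj => by simp [htr, hj]
  have hmem : MemLp F1 2 μ := by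
    refine MemLp.of_bound F1.continuous.aestronglyMeasurable ‖F1‖ ?_
    exact Filter.Eventually.of_forall fun x => F1.norm_coe_le_norm x
  refine ⟨L, F1, hmem, F1.continuous, ⟨‖F1‖, fun x => F1.norm_coe_le_norm x⟩, ?_, ?_⟩
  · intro x y hxy
    simp only [hF1, ContinuousMap.coe_mk]
    congr 1
    funext n
    by_cases hn : n < L
    · simp [htr, hn, hxy n hn]
    · simp [htr, hn]
  · have e1 : hmem.toLp F1 = ContinuousMap.toLp 2 μ ℂ F1 := by
      apply Lp.ext
      exact hmem.coeFn_toLp.trans (ContinuousMap.coeFn_toLp μ F1).symm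
    have e2 : ‖ContinuousMap.toLp (E := ℂ) 2 μ ℂ F0 - ContinuousMap.toLp 2 μ ℂ F1‖ ≤ ε / 4 := by
      rw [← map_sub]
      refine (Lp.norm_le_of_ae_bound (C := ε / 4) (by positivity) ?_).trans ?_
      · filter_upwards [ContinuousMap.coeFn_toLp (p := 2) (𝕜 := ℂ) μ (F0 - F1)] with x hx
        rw [hx]
        exact ((F0 - F1).norm_coe_le_norm x).trans hbd
      · simp [measureUnivNNReal]
    rw [e1]
    calc _ = ‖(g - ContinuousMap.toLp 2 μ ℂ F0) +
          (ContinuousMap.toLp (E := ℂ) 2 μ ℂ F0 - ContinuousMap.toLp 2 μ ℂ F1)‖ := by congr 1; abel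
      _ ≤ _ := norm_add_le _ _
      _ < ε := by linarith

/-- The Koopman operator. -/
noncomputable def koop (μ : Measure (ℕ → A)) (hμinv : MeasurePreserving (shiftMap A) μ μ) :
    Lp ℂ 2 μ →ₗᵢ[ℂ] Lp ℂ 2 μ :=
  Lp.compMeasurePreservingₗᵢ ℂ (shiftMap A) hμinv

theorem koop_coe (μ : Measure (ℕ → A)) (hμinv : MeasurePreserving (shiftMap A) μ μ)
    (g : Lp ℂ 2 μ) : ∀ᵐ x ∂μ, koop μ hμinv g x = g (shiftMap A x) :=
  Lp.coeFn_compMeasurePreserving g hμinv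

theorem koop_iter (μ : Measure (ℕ → A)) (hμinv : MeasurePreserving (shiftMap A) μ μ)
    (g : Lp ℂ 2 μ) (n : ℕ) :
    ∀ᵐ x ∂μ, (koop μ hμinv)^[n] g x = g ((shiftMap A)^[n] x) := by
  induction n with
  | zero => simp
  | succ n ih =>
    have h1 := koop_coe μ hμinv ((koop μ hμinv)^[n] g)
    have h2 := hμinv.quasiMeasurePreserving.ae ih
    filter_upwards [h1, h2] with x e1 e2
    rw [Function.iterate_succ_apply', e1, e2, Function.iterate_succ_apply]

theorem norm_sq_eq (μ : Measure (ℕ → A)) (g : Lp ℂ 2 μ) :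
    ENNReal.ofReal (‖g‖ ^ 2) = ∫⁻ x, ‖g x‖ₑ ^ 2 ∂μ := by
  rw [ENNReal.ofReal_pow (norm_nonneg _), ofReal_norm, Lp.enorm_def,
    eLpNorm_eq_lintegral_rpow_enorm_toReal (by norm_num) (by norm_num)]
  simp only [ENNReal.toReal_ofNat, ENNReal.rpow_ofNat]
  rw [← ENNReal.rpow_natCast, ← ENNReal.rpow_mul]
  norm_num

end MeasurePart

section MainPart

variable {A : Type*} [Fintype A] [TopologicalSpace A] [DiscreteTopology A]
    [MeasurableSpace A] [BorelSpace A]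

theorem return_tendsto {q : ℕ} (hq : 0 < q) (h2 : 2 ≤ q)
    (ξ : A → Fin q → A) (hprim : IsPrimitiveSubst hq ξ) (u : ℕ → A)
    (hufix : substApply hq ξ u = u)
    (μ : Measure (ℕ → A)) [IsProbabilityMeasure μ]
    (hμinv : MeasurePreserving (shiftMap A) μ μ)
    (hμsupp : μ (substOrbitClosure A u) = 1)
    (g : Lp ℂ 2 μ) (hg1 : ‖g‖ = 1) (c : ℂ) (hc1 : ‖c‖ = 1) (hg : koop μ hμinv g = c • g)
    (m : ℕ) (hm : u m = u 0) :
    Tendsto (fun n : ℕ => c ^ (q ^ n * m)) atTop (nhds 1) := by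
  obtain ⟨K, hK⟩ := syndetic hq h2 ξ hprim u hufix 0 m
  rw [Metric.tendsto_atTop]
  intro ε hε
  set η : ℝ := ε / (4 * (K + 1)) with hη
  have hη0 : 0 < η := by positivity
  obtain ⟨L, F, hF, -, -, hcyl, hgF⟩ := exists_cylinder_approx μ g η hη0
  refine ⟨2 * L, fun n hn => ?_⟩
  set Q := q ^ n with hQ
  have hQ0 : 0 < Q := by positivity
  have hQL : 2 * L ≤ Q := hn.trans (Nat.lt_pow_self (by omega)).le
  set M := Q * m with hM
  set E : Set (ℕ → A) := ⋂ j ∈ Finset.range L, {x : ℕ → A | x j = x (j + M)} with hE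
  have hEc : IsClopen E := isClopen_biInter_finset fun j _ => isClopen_coord j (j + M)
  have hEmem : ∀ x, x ∈ E ↔ ∀ j < L, x j = x (j + M) := by
    intro x; simp [hE]
  have hgm : Measurable fun x => ‖g x‖ₑ ^ 2 := (Lp.stronglyMeasurable g).measurable.enorm.pow_const 2
  have hginv : ∀ᵐ x ∂μ, ‖g (shiftMap A x)‖ₑ ^ 2 = ‖g x‖ₑ ^ 2 := by
    filter_upwards [koop_coe μ hμinv g, Lp.coeFn_smul c g] with x h1 h2
    rw [← h1, hg, h2, Pi.smul_apply, enorm_smul]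
    have : ‖c‖ₑ = 1 := by rw [← ofReal_norm, hc1]; simp
    rw [this, one_mul]
  have hden := density_block u μ hμinv hμsupp E hEc
    (fun t => u t = u 0 ∧ u (t + m) = u (0 + m)) K L Q hQ0 hK (by
      rintro t ⟨ht1, ht2⟩ j hj
      rw [hEmem]
      intro l hl
      rw [shift_iter, shift_iter]
      have e1 : l + (t * Q + j) = t * Q + (l + j) := by ring
      have e2 : l + M + (t * Q + j) = (t + m) * Q + (l + j) := by rw [hM]; ring
      rw [e1, e2, fix_block hq ξ u hufix n _ _ (by omega),
        fix_block hq ξ u hufix n _ _ (by omega), ht1, ht2, zero_add, hm])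
    (fun x => ‖g x‖ₑ ^ 2) hgm hginv
  rw [← norm_sq_eq μ g, hg1] at hden
  simp only [one_pow, ENNReal.ofReal_one, mul_one] at hden
  set J := ∫⁻ x in E, ‖g x‖ₑ ^ 2 ∂μ with hJ
  have hJ1 : 1 ≤ (2 * (K + 1) : ℕ) * J := by
    have hQ1 : (Q : ℝ≥0∞) ≤ 2 * ((Q - L : ℕ) : ℝ≥0∞) := by
      have : Q ≤ 2 * (Q - L) := by omega
      exact_mod_cast this
    have h3 : (Q : ℝ≥0∞) * 1 ≤ Q * ((2 * (K + 1) : ℕ) * J) := by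
      calc (Q : ℝ≥0∞) * 1 ≤ 2 * ((Q - L : ℕ) : ℝ≥0∞) := by rw [mul_one]; exact hQ1
        _ ≤ 2 * ((((K + 1) * Q : ℕ) : ℝ≥0∞) * J) := by gcongr
        _ = _ := by push_cast; ring
    exact (ENNReal.mul_le_mul_iff_right (by exact_mod_cast hQ0.ne') (ENNReal.natCast_ne_top _)).1 h3
  set d : Lp ℂ 2 μ := g - hF.toLp F with hd
  have hit : (koop μ hμinv)^[M] g = c ^ M • g := by
    generalize M = M'
    induction M' with
    | zero => simp
    | succ n ih => rw [Function.iterate_succ_apply', ih, map_smul, hg, smul_smul, pow_succ]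
  have hupper : ‖c ^ M - 1‖ₑ ^ 2 * J ≤ ENNReal.ofReal ((2 * η) ^ 2) := by
    calc ‖c ^ M - 1‖ₑ ^ 2 * J = ∫⁻ x in E, ‖c ^ M - 1‖ₑ ^ 2 * ‖g x‖ₑ ^ 2 ∂μ := by
          rw [lintegral_const_mul _ hgm]
      _ ≤ ∫⁻ x in E, ‖((koop μ hμinv)^[M] d - d : Lp ℂ 2 μ) x‖ₑ ^ 2 ∂μ := by
          refine lintegral_mono_ae ?_
          rw [ae_restrict_iff' hEc.1.measurableSet]
          have h1 := koop_iter μ hμinv g M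
          rw [hit] at h1
          have h2 := koop_iter μ hμinv d M
          have h3 : ∀ᵐ x ∂μ, d x = g x - F x := by
            filter_upwards [Lp.coeFn_sub g (hF.toLp F), hF.coeFn_toLp] with x e1 e2
            rw [hd, e1, Pi.sub_apply, e2]
          have h4 := (hμinv.iterate M).quasiMeasurePreserving.ae h3
          filter_upwards [h1, h2, h3, h4, Lp.coeFn_smul (c ^ M) g,
            Lp.coeFn_sub ((koop μ hμinv)^[M] d) d] with x e1 e2 e3 e4 e5 e6 hxE
          have e7 : F ((shiftMap A)^[M] x) = F x := by
            refine hcyl _ _ fun j hj => ?_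
            rw [shift_iter, (hEmem x).1 hxE j hj]
          rw [e6, Pi.sub_apply, e2, e4, e3, e7, ← e1, e5, Pi.smul_apply, ← mul_pow, ← enorm_mul]
          refine le_of_eq ?_
          congr 2
          rw [smul_eq_mul]; ring
      _ ≤ ∫⁻ x, ‖((koop μ hμinv)^[M] d - d : Lp ℂ 2 μ) x‖ₑ ^ 2 ∂μ := setLIntegral_le_lintegral _ _
      _ = ENNReal.ofReal (‖(koop μ hμinv)^[M] d - d‖ ^ 2) := (norm_sq_eq μ _).symm
      _ ≤ _ := by
          apply ENNReal.ofReal_le_ofReal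
          have hn : ∀ n (x : Lp ℂ 2 μ), ‖(koop μ hμinv)^[n] x‖ = ‖x‖ := by
            intro n
            induction n with
            | zero => intro x; rfl
            | succ n ih => intro x; rw [Function.iterate_succ_apply', LinearIsometry.norm_map, ih]
          have : ‖(koop μ hμinv)^[M] d - d‖ ≤ 2 * η := by
            refine (norm_sub_le _ _).trans ?_
            rw [hn]; linarith
          gcongr
  have hfin : ENNReal.ofReal (‖c ^ M - 1‖ ^ 2) ≤
      ENNReal.ofReal ((2 * (K + 1) : ℕ) * (2 * η) ^ 2) := by
    rw [ENNReal.ofReal_mul (by positivity), ENNReal.ofReal_natCast]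
    calc ENNReal.ofReal (‖c ^ M - 1‖ ^ 2) = ‖c ^ M - 1‖ₑ ^ 2 * 1 := by
          rw [ENNReal.ofReal_pow (norm_nonneg _), ofReal_norm, mul_one]
      _ ≤ ‖c ^ M - 1‖ₑ ^ 2 * ((2 * (K + 1) : ℕ) * J) := by gcongr
      _ = (2 * (K + 1) : ℕ) * (‖c ^ M - 1‖ₑ ^ 2 * J) := by ring
      _ ≤ _ := by gcongr
  rw [ENNReal.ofReal_le_ofReal_iff (by positivity)] at hfin
  rw [dist_eq_norm]
  have hcalc : ((2 * (K + 1) : ℕ) : ℝ) * (2 * η) ^ 2 = ε ^ 2 / (2 * (K + 1)) := by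
    rw [hη]; push_cast; field_simp; ring
  rw [hcalc] at hfin
  have hlt : ε ^ 2 / (2 * (K + 1)) < ε ^ 2 := by
    apply div_lt_self (by positivity)
    have : (0 : ℝ) ≤ K := Nat.cast_nonneg K
    linarith
  exact lt_of_pow_lt_pow_left₀ 2 hε.le (hfin.trans_lt hlt)

theorem forward_dir [DecidableEq A] {q : ℕ} (hq : 0 < q) (h2 : 2 ≤ q)
    (ξ : A → Fin q → A) (hprim : IsPrimitiveSubst hq ξ) (u : ℕ → A)
    (hufix : substApply hq ξ u = u)
    (μ : Measure (ℕ → A)) [IsProbabilityMeasure μ]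
    (hμinv : MeasurePreserving (shiftMap A) μ μ)
    (hμsupp : μ (substOrbitClosure A u) = 1)
    (hpp : HasPurePointSpectrum μ (shiftMap A)) :
    substColumnNumber hq ξ = substHeight hq ξ u := by
  refine le_antisymm ?_ (height_le_col hq h2 ξ hprim u hufix)
  by_contra hlt
  obtain ⟨i, m, hm, hbad⟩ := exists_bad_pair hq h2 ξ hprim u hufix (not_le.1 hlt)
  obtain ⟨ι, b, hb⟩ := hpp
  have hb' : ∀ i, ∃ c : ℂ, koop μ hμinv (b i) = c • b i ∧
      Tendsto (fun n : ℕ => c ^ (q ^ n * m)) atTop (nhds 1) := by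
    intro i
    obtain ⟨c, hc⟩ := hb i
    have h1 : koop μ hμinv (b i) = c • b i := by
      apply Lp.ext
      filter_upwards [koop_coe μ hμinv (b i), hc, Lp.coeFn_smul c (b i)] with x e1 e2 e3
      rw [e1, e2, e3]; rfl
    have hn : ‖b i‖ = 1 := b.orthonormal.1 i
    have hc1 : ‖c‖ = 1 := eigen_norm_one (koop μ hμinv) (by intro h; simp [h] at hn) h1
    exact ⟨c, h1, eigenvalue_tendsto hq h2 ξ hprim u hufix c hc1
      (fun m hm => return_tendsto hq h2 ξ hprim u hufix μ hμinv hμsupp (b i) hn c hc1 h1 m hm) m hm⟩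
  obtain ⟨e⟩ : Nonempty (A ≃ Fin (Fintype.card A)) := ⟨Fintype.equivFin A⟩
  set F : (ℕ → A) → ℂ := fun x => ((e (x 0) : ℕ) : ℂ) with hF
  have hFc : Continuous F :=
    (continuous_of_discreteTopology (f := fun a : A => ((e a : ℕ) : ℂ))).comp (continuous_apply 0)
  have hFm : MemLp F 2 μ := by
    refine MemLp.of_bound hFc.aestronglyMeasurable (Fintype.card A) ?_
    refine Filter.Eventually.of_forall fun x => ?_
    simp only [hF, Complex.norm_natCast]
    exact_mod_cast (e (x 0)).2.le
  have ht := tendsto_of_eigenbasis (koop μ hμinv) b (fun n => q ^ n * m) hb' (hFm.toLp F)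
  obtain ⟨K, hK⟩ := syndetic hq h2 ξ hprim u hufix i m
  have hlow : ∀ n, 1 ≤ ((K : ℝ) + 1) * ‖(koop μ hμinv)^[q ^ n * m] (hFm.toLp F) - hFm.toLp F‖ ^ 2 := by
    intro n
    set Q := q ^ n with hQ
    have hQ0 : 0 < Q := by positivity
    set M := Q * m with hM
    set E : Set (ℕ → A) := {x : ℕ → A | x 0 = x M}ᶜ with hE
    have hEc : IsClopen E := (isClopen_coord 0 M).compl
    have hden := density_block u μ hμinv hμsupp E hEc
      (fun t => u t = u i ∧ u (t + m) = u (i + m)) K 0 Q hQ0 hK (by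
        rintro t ⟨ht1, ht2⟩ j hj
        simp only [hE, Set.mem_compl_iff, Set.mem_ofPred_eq]
        rw [shift_iter, shift_iter]
        have e1 : 0 + (t * Q + j) = t * Q + j := by ring
        have e2 : M + (t * Q + j) = (t + m) * Q + j := by rw [hM]; ring
        rw [e1, e2, fix_block hq ξ u hufix n _ _ (by omega),
          fix_block hq ξ u hufix n _ _ (by omega), ht1, ht2]
        exact hbad n j (by omega))
      (fun _ => 1) measurable_const (by simp)
    simp only [lintegral_const, measure_univ, mul_one, Nat.sub_zero, one_mul,
      Measure.restrict_apply_univ] at hden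
    have hE1 : 1 ≤ ((K + 1 : ℕ) : ℝ≥0∞) * μ E := by
      have h3 : (Q : ℝ≥0∞) * 1 ≤ Q * (((K + 1 : ℕ) : ℝ≥0∞) * μ E) := by
        rw [mul_one]
        refine hden.trans (le_of_eq ?_)
        push_cast; ring
      exact (ENNReal.mul_le_mul_iff_right (by exact_mod_cast hQ0.ne')
        (ENNReal.natCast_ne_top _)).1 h3
    have hE2 : μ E ≤ ENNReal.ofReal (‖(koop μ hμinv)^[M] (hFm.toLp F) - hFm.toLp F‖ ^ 2) := by
      rw [norm_sq_eq]
      rw [← lintegral_indicator_one hEc.1.measurableSet]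
      refine lintegral_mono_ae ?_
      have h4 := (hμinv.iterate M).quasiMeasurePreserving.ae hFm.coeFn_toLp
      filter_upwards [koop_iter μ hμinv (hFm.toLp F) M, hFm.coeFn_toLp, h4,
        Lp.coeFn_sub ((koop μ hμinv)^[M] (hFm.toLp F)) (hFm.toLp F)] with x e1 e2 e3 e4
      by_cases hx : x ∈ E
      · rw [Set.indicator_of_mem hx, e4, Pi.sub_apply, e1, e2, e3]
        simp only [hF, shift_iter, zero_add, Pi.one_apply]
        have hne : ((e (x M) : ℕ) : ℤ) - ((e (x 0) : ℕ) : ℤ) ≠ 0 := by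
          intro h0
          apply hx
          have : (e (x M) : ℕ) = (e (x 0) : ℕ) := by omega
          exact (e.injective (Fin.ext this)).symm
        have h1 : (1 : ℝ) ≤ ‖(((e (x M) : ℕ) : ℂ) - ((e (x 0) : ℕ) : ℂ))‖ := by
          have h5 : (((e (x M) : ℕ) : ℂ) - ((e (x 0) : ℕ) : ℂ)) =
              (((((e (x M) : ℕ) : ℤ) - ((e (x 0) : ℕ) : ℤ)) : ℤ) : ℂ) := by push_cast; rfl
          rw [h5, Complex.norm_intCast]
          exact_mod_cast Int.one_le_abs hne
        have h6 : (1 : ℝ≥0∞) ≤ ‖(((e (x M) : ℕ) : ℂ) - ((e (x 0) : ℕ) : ℂ))‖ₑ := by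
          rw [← ofReal_norm, ENNReal.one_le_ofReal]; exact h1
        exact one_le_pow₀ h6
      · rw [Set.indicator_of_notMem hx]; exact zero_le
    have hE3 : ENNReal.ofReal 1 ≤ ENNReal.ofReal (((K : ℝ) + 1) *
        ‖(koop μ hμinv)^[M] (hFm.toLp F) - hFm.toLp F‖ ^ 2) := by
      rw [ENNReal.ofReal_mul (by positivity), ENNReal.ofReal_one]
      have : ENNReal.ofReal ((K : ℝ) + 1) = ((K + 1 : ℕ) : ℝ≥0∞) := by
        rw [← ENNReal.ofReal_natCast]; push_cast; rfl
      rw [this]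
      exact hE1.trans (by gcongr)
    exact (ENNReal.ofReal_le_ofReal_iff (by positivity)).1 hE3
  have hlim := ((ht.pow 2).const_mul ((K : ℝ) + 1))
  have := ge_of_tendsto' hlim hlow
  norm_num at this

open Classical in
theorem small_density [DecidableEq A] {q : ℕ} (hq : 0 < q) (h2 : 2 ≤ q)
    (ξ : A → Fin q → A) (hprim : IsPrimitiveSubst hq ξ) (u : ℕ → A)
    (hufix : substApply hq ξ u = u)
    (μ : Measure (ℕ → A)) [IsProbabilityMeasure μ]
    (hμinv : MeasurePreserving (shiftMap A) μ μ)
    (hμsupp : μ (substOrbitClosure A u) = 1)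
    (hc : substColumnNumber hq ξ = substHeight hq ξ u) (δ : ℝ) (hδ : 0 < δ) :
    ∃ r : ℕ, 0 < r ∧ ∀ t : ℕ, μ {x : ℕ → A | x 0 = x (r * t)}ᶜ ≤ ENNReal.ofReal δ := by
  obtain ⟨hpos, -⟩ := height_spec hq h2 ξ hprim u hufix
  obtain ⟨n0, hn0, hgood⟩ := good_columns hq h2 ξ hprim u hufix hc
  have hQ0 : 0 < q ^ n0 := by positivity
  have hQR : (0 : ℝ) < (q : ℝ) ^ n0 := by exact_mod_cast hQ0
  obtain ⟨k, hk⟩ := exists_pow_lt_of_lt_one hδ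
    (show (((q ^ n0 - 1 : ℕ) : ℝ) / ((q ^ n0 : ℕ) : ℝ)) < 1 by
      rw [div_lt_one (by exact_mod_cast hQ0)]
      exact_mod_cast Nat.sub_lt hQ0 one_pos)
  obtain ⟨B, hB, hgd⟩ := hgood k
  set N := q ^ (n0 * k) with hN
  have hN0 : 0 < N := by positivity
  have hBN : (B.card : ℝ) ≤ δ * N := by
    have h3 : (B.card : ℝ) ≤ ((q ^ n0 - 1 : ℕ) : ℝ) ^ k := by exact_mod_cast hB
    have h4 : (N : ℝ) = ((q ^ n0 : ℕ) : ℝ) ^ k := by rw [hN, pow_mul]; push_cast; rfl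
    rw [div_pow, ← h4, div_lt_iff₀ (by exact_mod_cast hN0)] at hk
    exact h3.trans hk.le
  refine ⟨substHeight hq ξ u * N, by positivity, fun t => ?_⟩
  set M := substHeight hq ξ u * N * t with hM
  set E : Set (ℕ → A) := {x : ℕ → A | x 0 = x M} with hE
  have hEc : IsClopen E := isClopen_coord 0 M
  have hden := density_lower u μ hμinv hμsupp E hEc N (N - B.card) (fun s => by
    have hsub : Finset.range N ⊆ ((Finset.range N).filter fun i => (shiftMap A)^[s + i] u ∈ E) ∪
        ((Finset.range N).filter fun i => (s + i) % N ∈ B) := by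
      intro i hi
      by_cases hib : (s + i) % N ∈ B
      · exact Finset.mem_union_right _ (Finset.mem_filter.2 ⟨hi, hib⟩)
      · refine Finset.mem_union_left _ (Finset.mem_filter.2 ⟨hi, ?_⟩)
        simp only [hE, Set.mem_ofPred_eq]
        rw [shift_iter, shift_iter]
        have e0 := Nat.div_add_mod' (s + i) N
        have e1 : 0 + (s + i) = (s + i) / N * N + (s + i) % N := by omega
        have e2 : M + (s + i) = ((s + i) / N + substHeight hq ξ u * t) * N + (s + i) % N := by
          have : ((s + i) / N + substHeight hq ξ u * t) * N = (s + i) / N * N + M := by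
            rw [hM]; ring
          rw [this]; omega
        rw [e1, e2]
        exact hgd _ (Nat.mod_lt _ hN0) hib _ _ (by simp [Nat.ModEq])
    have h3 := (Finset.card_le_card hsub).trans (Finset.card_union_le _ _)
    have h4 : ((Finset.range N).filter fun i => (s + i) % N ∈ B).card ≤ B.card := by
      refine Finset.card_le_card_of_injOn (fun i => (s + i) % N) ?_ ?_
      · intro i hi
        exact (Finset.mem_filter.1 hi).2
      · intro i hi j hj hij
        have hi' := Finset.mem_range.1 (Finset.mem_filter.1 hi).1
        have hj' := Finset.mem_range.1 (Finset.mem_filter.1 hj).1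
        exact Nat.ModEq.eq_of_lt_of_lt (Nat.ModEq.add_left_cancel' s hij) hi' hj'
    rw [Finset.card_range] at h3
    have h5 : N - B.card ≤ ((Finset.range N).filter fun i => (shiftMap A)^[s + i] u ∈ E).card := by
      omega
    convert h5) (fun _ => 1) measurable_const (by simp)
  simp only [lintegral_const, measure_univ, mul_one, one_mul,
    Measure.restrict_apply_univ] at hden
  have hmu : μ E = ENNReal.ofReal (μ.real E) := by
    rw [Measure.real, ENNReal.ofReal_toReal (measure_ne_top _ _)]
  rw [hmu, ← ENNReal.ofReal_natCast N, ← ENNReal.ofReal_mul (by positivity),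
    ← ENNReal.ofReal_natCast, ENNReal.ofReal_le_ofReal_iff (by positivity)] at hden
  have hden2 : (N : ℝ) - B.card ≤ N * μ.real E := by
    refine le_trans ?_ hden
    rw [sub_le_iff_le_add]
    have : N ≤ (N - B.card) + B.card := by omega
    exact_mod_cast this
  have hcompl : μ.real Eᶜ = 1 - μ.real E := probReal_compl_eq_one_sub hEc.1.measurableSet
  rw [← ENNReal.ofReal_toReal (measure_ne_top μ Eᶜ)]
  apply ENNReal.ofReal_le_ofReal
  change μ.real Eᶜ ≤ δ
  rw [hcompl]
  have hNR : (0 : ℝ) < N := by exact_mod_cast hN0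
  have : (N : ℝ) * (1 - μ.real E) ≤ N * δ := by linarith
  exact le_of_mul_le_mul_left this hNR

theorem backward_dir [DecidableEq A] {q : ℕ} (hq : 0 < q) (h2 : 2 ≤ q)
    (ξ : A → Fin q → A) (hprim : IsPrimitiveSubst hq ξ) (u : ℕ → A)
    (hufix : substApply hq ξ u = u)
    (μ : Measure (ℕ → A)) [IsProbabilityMeasure μ]
    (hμinv : MeasurePreserving (shiftMap A) μ μ)
    (hμsupp : μ (substOrbitClosure A u) = 1)
    (hc : substColumnNumber hq ξ = substHeight hq ξ u) :
    HasPurePointSpectrum μ (shiftMap A) := by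
  have hfact : Fact ((2 : ℝ≥0∞) ≠ ∞) := ⟨by norm_num⟩
  have hfact1 : Fact ((1 : ℝ≥0∞) ≤ 2) := ⟨by norm_num⟩
  have hsc : SecondCountableTopology (ℕ → A) := inferInstance
  have hcg : MeasurableSpace.CountablyGenerated (ℕ → A) := inferInstance
  have hsep : IsSeparable μ := inferInstance
  have hscl : SecondCountableTopology (Lp ℂ 2 μ) := Lp.SecondCountableTopology
  obtain ⟨ι, b, hb⟩ := exists_eigenbasis (koop μ hμinv) (by
    intro f
    rw [← closure_closure, Metric.mem_closure_iff]
    intro ε hε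
    obtain ⟨L, F, hF, hFc, ⟨C, hC⟩, hcyl, hfF⟩ := exists_cylinder_approx μ f ε hε
    refine ⟨hF.toLp F, ?_, by rwa [dist_eq_norm]⟩
    apply mem_closure_eigSpan
    intro ε' hε'
    obtain ⟨r, hr, hrt⟩ := small_density hq h2 ξ hprim u hufix μ hμinv hμsupp hc
      (ε' ^ 2 / (4 * C ^ 2 * L + 1)) (by positivity)
    refine ⟨r, hr, fun t => ?_⟩
    set M := r * t with hM
    set δ := ε' ^ 2 / (4 * C ^ 2 * L + 1) with hδ
    set D : Set (ℕ → A) := ⋃ j ∈ Finset.range L, {x : ℕ → A | x j = x (j + M)}ᶜ with hD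
    have hDm : MeasurableSet D :=
      Finset.measurableSet_biUnion _ fun j _ => (isClopen_coord j (j + M)).compl.1.measurableSet
    have hmuD : μ D ≤ L * ENNReal.ofReal δ := by
      refine (measure_biUnion_finset_le _ _).trans ?_
      calc _ ≤ ∑ j ∈ Finset.range L, ENNReal.ofReal δ := by
            refine Finset.sum_le_sum fun j _ => ?_
            have h1 : {x : ℕ → A | x j = x (j + M)}ᶜ =
                (shiftMap A)^[j] ⁻¹' {x : ℕ → A | x 0 = x M}ᶜ := by
              ext x
              simp [shift_iter, add_comm]
            rw [h1, (hμinv.iterate j).measure_preimage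
              (isClopen_coord 0 M).compl.1.measurableSet.nullMeasurableSet]
            exact hrt t
        _ = _ := by simp
    have hsq : ENNReal.ofReal (‖(koop μ hμinv)^[M] (hF.toLp F) - hF.toLp F‖ ^ 2) ≤
        ENNReal.ofReal (4 * C ^ 2 * (L * δ)) := by
      rw [norm_sq_eq]
      calc _ ≤ ∫⁻ x, D.indicator (fun _ => ENNReal.ofReal (4 * C ^ 2)) x ∂μ := by
            refine lintegral_mono_ae ?_
            have h4 := (hμinv.iterate M).quasiMeasurePreserving.ae hF.coeFn_toLp
            filter_upwards [koop_iter μ hμinv (hF.toLp F) M, hF.coeFn_toLp, h4,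
              Lp.coeFn_sub ((koop μ hμinv)^[M] (hF.toLp F)) (hF.toLp F)] with x e1 e2 e3 e4
            rw [e4, Pi.sub_apply, e1, e2, e3]
            by_cases hx : x ∈ D
            · rw [Set.indicator_of_mem hx, ← ofReal_norm, ← ENNReal.ofReal_pow (norm_nonneg _)]
              apply ENNReal.ofReal_le_ofReal
              have h5 : ‖F ((shiftMap A)^[M] x) - F x‖ ≤ 2 * C :=
                (norm_sub_le _ _).trans (by linarith [hC ((shiftMap A)^[M] x), hC x])
              calc _ ≤ (2 * C) ^ 2 := by gcongr
                _ = _ := by ring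
            · have h6 : F ((shiftMap A)^[M] x) = F x := by
                refine hcyl _ _ fun j hj => ?_
                rw [shift_iter]
                by_contra hne
                apply hx
                simp only [hD, Set.mem_iUnion]
                exact ⟨j, Finset.mem_range.2 hj, fun h => hne h.symm⟩
              rw [h6, sub_self]; simp
        _ = ENNReal.ofReal (4 * C ^ 2) * μ D := lintegral_indicator_const hDm _
        _ ≤ ENNReal.ofReal (4 * C ^ 2) * (L * ENNReal.ofReal δ) := by gcongr
        _ = _ := by
            rw [ENNReal.ofReal_mul (p := 4 * C ^ 2) (by positivity),
              ENNReal.ofReal_mul (p := (L : ℝ)) (by positivity), ENNReal.ofReal_natCast]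
    rw [ENNReal.ofReal_le_ofReal_iff (by positivity)] at hsq
    have hle : 4 * C ^ 2 * (L * δ) ≤ ε' ^ 2 := by
      have h7 : (0 : ℝ) < 4 * C ^ 2 * L + 1 := by positivity
      rw [hδ, ← mul_assoc, mul_div_assoc', div_le_iff₀ h7]
      nlinarith [sq_nonneg ε']
    exact (sq_le_sq₀ (norm_nonneg _) hε'.le).1 (hsq.trans hle))
  refine ⟨ι, b, fun i => ?_⟩
  obtain ⟨c, hc⟩ := hb i
  refine ⟨c, ?_⟩
  have h1 := koop_coe μ hμinv (b i)
  rw [hc] at h1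
  filter_upwards [h1, Lp.coeFn_smul c (b i)] with x e1 e2
  rw [← e1, e2]; rfl

end MainPart

/-- For an injective primitive substitution `ξ` of constant length `q` on a finite
alphabet `A`, `|A| > 1`, with fixed point `u` starting with `α`, the uniquely ergodic
substitutional system `(X_ξ, μ^ξ, T)` has purely point spectrum if and only if
`c(ξ) = h(ξ)`. -/
theorem purePointSpectrum_subst_iff
    {A : Type*} [Fintype A] [DecidableEq A] [TopologicalSpace A] [DiscreteTopology A]
    [MeasurableSpace A] [BorelSpace A]
    (hcard : 1 < Fintype.card A)
    {q : ℕ} (hq : 0 < q) (ξ : A → Fin q → A)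
    (hinj : Function.Injective ξ) (hprim : IsPrimitiveSubst hq ξ)
    (α : A) (hα : ξ α ⟨0, hq⟩ = α)
    (u : ℕ → A) (hu0 : u 0 = α) (hufix : substApply hq ξ u = u)
    (μ : Measure (ℕ → A)) [IsProbabilityMeasure μ]
    (hμinv : MeasurePreserving (shiftMap A) μ μ)
    (hμsupp : μ (substOrbitClosure A u) = 1) :
    HasPurePointSpectrum μ (shiftMap A) ↔ substColumnNumber hq ξ = substHeight hq ξ u := by
  have h2 := two_le_q hcard hq ξ hprim
  exact ⟨forward_dir hq h2 ξ hprim u hufix μ hμinv hμsupp,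
    backward_dir hq h2 ξ hprim u hufix μ hμinv hμsupp⟩
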